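/- arXiv:1304.2191 — 4 statements merged into one kernel-verified Lean document; each statement's English description precedes it below -/
import Mathlib

section
/- Let S be a nonempty finite set of prime numbers and let ε : S → {−1, 1} be a function. Then the set of odd primes p (with p not in S) such that the Legendre symbol χ_p(q) = ε(q) for every q ∈ S has density 2^{−|S|} in the set of all primes. -/
/-- The density of a set `P` of primes within the set of all primes:
the limit as `x → ∞` of `|{p ∈ P : p ≤ x}| / |{p prime : p ≤ x}|`. -/
def HasPrimeDensity (P : Set ℕ) (δ : ℝ) : Prop :=
  Filter.Tendsto
    (fun x : ℕ => (({p ∈ P | p ≤ x}.ncard : ℝ) / ({p | Nat.Prime p ∧ p ≤ x}.ncard : ℝ)))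
    Filter.atTop (nhds δ)

section

open Filter Topology MeasureTheory Set

/-- A one-sided Tauberian principle: if the means of a bounded function `f` against all
rescalings of a nonnegative kernel tend to zero and large values of `f` persist on nearby
intervals, then `limsup f ≤ 0`. -/
theorem eventually_lt_of_tendsto_kernel_mean {K f : ℝ → ℝ} {M : ℝ}
    (hK : Integrable K) (hK0 : ∀ u, 0 ≤ K u) (hKpos : 0 < ∫ u, K u)
    (hf : Measurable f) (hM : ∀ t, |f t| ≤ M)
    (hmean : ∀ l : ℝ, 0 < l → Tendsto (fun y => ∫ t, f t * K (l * (y - t))) atTop (𝓝 0))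
    {δ : ℝ} (hδ : 0 < δ)
    (hslow : ∃ η > 0, ∀ᶠ y in atTop, δ ≤ f y →
      ∃ z, y - η ≤ z ∧ ∀ t, |z - t| ≤ η → δ / 2 ≤ f t) :
    ∀ᶠ y in atTop, f y < δ := by
  obtain ⟨η, hη, hs⟩ := hslow
  set I := ∫ u, K u with hI
  have hM0 : 0 ≤ M := (abs_nonneg _).trans (hM 0)
  -- the tail of the kernel is small
  have htail : Tendsto (fun R : ℝ => ∫ u in Icc (-R) R, K u) atTop (𝓝 I) := by
    have := (MeasureTheory.aecover_Icc (μ := (volume : Measure ℝ)) tendsto_neg_atTop_atBot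
      tendsto_id).integral_tendsto_of_countably_generated hK
    simpa using this
  have hlim : Tendsto (fun R : ℝ => (M + δ / 2) * (∫ u in Icc (-R) R, K u) - M * I) atTop
      (𝓝 (δ / 2 * I)) := by
    have := (htail.const_mul (M + δ / 2)).sub_const (M * I)
    convert this using 2; ring
  obtain ⟨R, hR, hR0⟩ := ((hlim.eventually (lt_mem_nhds (show δ / 4 * I < δ / 2 * I by
    nlinarith))).and (eventually_gt_atTop 0)).exists
  set l := R / η with hl
  have hl0 : 0 < l := by positivity
  have hlow : ∀ z, (∀ t, |z - t| ≤ η → δ / 2 ≤ f t) →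
      δ / 4 * I / l ≤ ∫ t, f t * K (l * (z - t)) := by
    intro z hz
    have hKl : Integrable (fun t => K (l * (z - t))) :=
      (hK.comp_mul_left' hl0.ne').comp_sub_left z
    set h : ℝ → ℝ := fun u => (M + δ / 2) * (Icc (-R) R).indicator K u - M * K u with hh
    have h_int : Integrable h :=
      ((hK.indicator measurableSet_Icc).const_mul _).sub (hK.const_mul _)
    have h1 : ∫ t, h (l * (z - t)) = (∫ u, h u) / l := by
      rw [integral_sub_left_eq_self (fun t => h (l * t)) volume z, Measure.integral_comp_mul_left]
      rw [abs_of_pos (by positivity), smul_eq_mul, div_eq_inv_mul]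
    have h2 : ∫ u, h u = (M + δ / 2) * (∫ u in Icc (-R) R, K u) - M * I := by
      rw [hh, integral_sub ((hK.indicator measurableSet_Icc).const_mul _) (hK.const_mul _),
        integral_const_mul, integral_const_mul, integral_indicator measurableSet_Icc]
    calc δ / 4 * I / l ≤ (∫ u, h u) / l := by rw [h2]; gcongr
      _ = ∫ t, h (l * (z - t)) := h1.symm
      _ ≤ _ := by
        refine integral_mono ((h_int.comp_mul_left' hl0.ne').comp_sub_left z) ?_ fun t => ?_
        · exact hKl.bdd_mul hf.aestronglyMeasurable (Eventually.of_forall hM)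
        · have hk := hK0 (l * (z - t))
          have hft := (abs_le.1 (hM t)).1
          simp only [hh]
          by_cases ht : l * (z - t) ∈ Icc (-R) R
          · rw [indicator_of_mem ht]
            have : δ / 2 ≤ f t := by
              apply hz
              have h3 : |l * (z - t)| ≤ R := abs_le.2 ht
              rw [abs_mul, abs_of_pos hl0, hl, div_mul_eq_mul_div, div_le_iff₀ hη] at h3
              exact le_of_mul_le_mul_left h3 hR0
            nlinarith
          · rw [indicator_of_notMem ht]
            nlinarith
  have hsmall := (hmean l hl0).eventually (gt_mem_nhds (show 0 < δ / 4 * I / l by positivity))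
  obtain ⟨Y, hY⟩ := eventually_atTop.1 hsmall
  filter_upwards [hs, eventually_ge_atTop (Y + η)] with y hy hyY
  by_contra! hcon
  obtain ⟨z, hzy, hz⟩ := hy hcon
  exact absurd (hY z (by linarith)) (not_lt.2 (hlow z hz))

/-- The Fejér kernel on the real line, up to normalisation. -/
noncomputable def fejer (u : ℝ) : ℝ := 2 * (1 - Real.cos u) / u ^ 2

theorem fejer_nonneg (u : ℝ) : 0 ≤ fejer u := by
  have := Real.cos_le_one u
  unfold fejer
  have : 0 ≤ 1 - Real.cos u := by linarith
  positivity

theorem measurable_fejer : Measurable fejer := by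
  unfold fejer; fun_prop

theorem fejer_le (u : ℝ) : fejer u ≤ 5 * (1 + u ^ 2)⁻¹ := by
  rcases eq_or_ne u 0 with rfl | hu
  · simp [fejer]
  have h1 := Real.one_sub_sq_div_two_le_cos (x := u)
  have h2 := Real.neg_one_le_cos u
  unfold fejer
  rw [← div_eq_mul_inv, div_le_div_iff₀ (by positivity) (by positivity)]
  nlinarith [sq_nonneg u]

theorem integrable_fejer : Integrable fejer :=
  (integrable_inv_one_add_sq.const_mul 5).mono' measurable_fejer.aestronglyMeasurable
    (Eventually.of_forall fun u => by
      rw [Real.norm_of_nonneg (fejer_nonneg u)]; exact fejer_le u)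

theorem integral_fejer_pos : 0 < ∫ u, fejer u := by
  rw [integral_pos_iff_support_of_nonneg fejer_nonneg integrable_fejer]
  refine lt_of_lt_of_le ?_ (measure_mono (s := Ioo 0 1) fun u hu => ?_)
  · simp
  · have : Real.cos u < 1 := by
      have := Real.cos_lt_cos_of_nonneg_of_le_pi le_rfl (by linarith [Real.pi_gt_three, hu.2]) hu.1
      simpa using this
    have h2 : 0 < 1 - Real.cos u := by linarith
    have h3 := hu.1
    exact (show 0 < fejer u by unfold fejer; positivity).ne'

theorem integral_triangle_exp {u : ℝ} (hu : u ≠ 0) :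
    ∫ τ in (-1 : ℝ)..1, ((1 - |τ| : ℝ) : ℂ) * Complex.exp (Complex.I * τ * u) = fejer u := by
  have huC : (u : ℂ) ≠ 0 := by exact_mod_cast hu
  have key : ∀ (e : ℂ) (a b : ℝ), ∫ τ in a..b, (1 + e * τ) * Complex.exp (Complex.I * τ * u) =
      ((1 + e * b) * Complex.exp (Complex.I * b * u) / (Complex.I * u) +
        e * Complex.exp (Complex.I * b * u) / u ^ 2) -
      ((1 + e * a) * Complex.exp (Complex.I * a * u) / (Complex.I * u) +
        e * Complex.exp (Complex.I * a * u) / u ^ 2) := by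
    intro e a b
    refine intervalIntegral.integral_eq_sub_of_hasDerivAt
      (f := fun τ : ℝ => (1 + e * τ) * Complex.exp (Complex.I * τ * u) / (Complex.I * u) +
        e * Complex.exp (Complex.I * τ * u) / u ^ 2) (fun τ _ => ?_)
      (Continuous.intervalIntegrable (by fun_prop) _ _)
    have h0 : HasDerivAt (fun τ : ℝ => (τ : ℂ)) 1 τ := Complex.ofRealCLM.hasDerivAt
    have h1 : HasDerivAt (fun τ : ℝ => Complex.exp (Complex.I * τ * u))
        (Complex.exp (Complex.I * τ * u) * (Complex.I * 1 * u)) τ :=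
      ((h0.const_mul Complex.I).mul_const (u : ℂ)).cexp
    have h2 := ((((h0.const_mul e).const_add 1).mul h1).div_const (Complex.I * u)).add
      ((h1.const_mul e).div_const ((u : ℂ) ^ 2))
    refine h2.congr_deriv ?_
    have := Complex.I_sq
    field_simp
    linear_combination e * this
  have h_int : ∀ a b, IntervalIntegrable (fun τ : ℝ => ((1 - |τ| : ℝ) : ℂ) *
      Complex.exp (Complex.I * τ * u)) volume a b := fun a b =>
    Continuous.intervalIntegrable (by fun_prop) _ _
  rw [← intervalIntegral.integral_add_adjacent_intervals (h_int (-1) 0) (h_int 0 1)]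
  have e1 : ∫ τ in (-1 : ℝ)..0, ((1 - |τ| : ℝ) : ℂ) * Complex.exp (Complex.I * τ * u) =
      ∫ τ in (-1 : ℝ)..0, (1 + 1 * (τ : ℂ)) * Complex.exp (Complex.I * τ * u) := by
    refine intervalIntegral.integral_congr fun τ hτ => ?_
    rw [uIcc_of_le (by norm_num)] at hτ
    simp only [abs_of_nonpos hτ.2]; push_cast; ring
  have e2 : ∫ τ in (0 : ℝ)..1, ((1 - |τ| : ℝ) : ℂ) * Complex.exp (Complex.I * τ * u) =
      ∫ τ in (0 : ℝ)..1, (1 + (-1) * (τ : ℂ)) * Complex.exp (Complex.I * τ * u) := by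
    refine intervalIntegral.integral_congr fun τ hτ => ?_
    rw [uIcc_of_le (by norm_num)] at hτ
    simp only [abs_of_nonneg hτ.1]; push_cast; ring
  rw [e1, e2, key, key, fejer]
  push_cast
  rw [Complex.cos]
  have h3 : Complex.I * (-1 : ℂ) * u = -(u : ℂ) * Complex.I := by ring
  have h4 : Complex.I * (1 : ℂ) * u = (u : ℂ) * Complex.I := by ring
  rw [h3, h4]
  simp only [mul_zero, zero_mul, Complex.exp_zero]
  field_simp
  ring

theorem integral_mul_fejer_eq {f : ℝ → ℝ} {M : ℝ} (hf : Measurable f) (hM : ∀ t, |f t| ≤ M)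
    {G : ℂ → ℂ} (hGf : ∀ s : ℂ, 0 < s.re → ∫ t in Ioi (0 : ℝ), (f t : ℂ) * Complex.exp (-s * t) = G s)
    {l σ : ℝ} (hl : 0 < l) (hσ : 0 < σ) (y : ℝ) :
    ∫ t in Ioi (0 : ℝ), ((f t * Real.exp (-σ * t) * fejer (l * (y - t)) : ℝ) : ℂ) =
      ∫ τ in Ioc (-1 : ℝ) 1, ((1 - |τ| : ℝ) : ℂ) * Complex.exp (Complex.I * τ * (l * y : ℝ)) *
        G (σ + Complex.I * (l * τ : ℝ)) := by
  have hM0 : 0 ≤ M := (abs_nonneg _).trans (hM 0)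
  set Φ : ℝ → ℝ → ℂ := fun t τ => ((f t * Real.exp (-σ * t) : ℝ) : ℂ) *
    (((1 - |τ| : ℝ) : ℂ) * Complex.exp (Complex.I * τ * (l * (y - t) : ℝ))) with hΦ
  have h_int : Integrable (Function.uncurry Φ)
      ((volume.restrict (Ioi (0 : ℝ))).prod (volume.restrict (Ioc (-1 : ℝ) 1))) := by
    have h1 : Integrable (fun t : ℝ => M * Real.exp (-σ * t)) (volume.restrict (Ioi (0 : ℝ))) :=
      (exp_neg_integrableOn_Ioi 0 hσ).const_mul M
    have h2 : Integrable (fun τ : ℝ => (2 : ℝ)) (volume.restrict (Ioc (-1 : ℝ) 1)) :=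
      integrable_const _
    refine (h1.mul_prod h2).mono' ?_ ?_
    · refine Measurable.aestronglyMeasurable ?_
      simp only [hΦ, Function.uncurry_def]
      fun_prop
    · have hae : ∀ᵐ z : ℝ × ℝ ∂((volume.restrict (Ioi (0 : ℝ))).prod
          (volume.restrict (Ioc (-1 : ℝ) 1))), z.2 ∈ Ioc (-1 : ℝ) 1 :=
        Measure.quasiMeasurePreserving_snd.ae (ae_restrict_mem measurableSet_Ioc)
      filter_upwards [hae] with z hz
      simp only [hΦ, Function.uncurry_def, norm_mul, Complex.norm_real]
      have h3 : ‖Complex.exp (Complex.I * z.2 * (l * (y - z.1) : ℝ))‖ = 1 := by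
        rw [show Complex.I * z.2 * (l * (y - z.1) : ℝ) =
          ((z.2 * (l * (y - z.1)) : ℝ) : ℂ) * Complex.I by push_cast; ring]
        exact Complex.norm_exp_ofReal_mul_I _
      have h4 : ‖(1 - |z.2| : ℝ)‖ ≤ 2 := by
        have := abs_le.2 ⟨hz.1.le, hz.2⟩
        rw [Real.norm_eq_abs, abs_le]
        constructor <;> linarith [abs_nonneg z.2]
      rw [h3, mul_one, Real.norm_of_nonneg (Real.exp_nonneg (-σ * z.1))]
      gcongr
      exact hM _
  calc _ = ∫ t in Ioi (0 : ℝ), ∫ τ in Ioc (-1 : ℝ) 1, Φ t τ := by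
        refine integral_congr_ae ?_
        have : ∀ᵐ t : ℝ ∂(volume.restrict (Ioi (0 : ℝ))), t ≠ y :=
          ae_restrict_of_ae (Measure.ae_ne volume y)
        filter_upwards [this] with t ht
        have hne : l * (y - t) ≠ 0 := mul_ne_zero hl.ne' (sub_ne_zero.2 ht.symm)
        simp only [hΦ]
        rw [integral_const_mul, ← intervalIntegral.integral_of_le (by norm_num),
          integral_triangle_exp hne]
        push_cast; ring
    _ = ∫ τ in Ioc (-1 : ℝ) 1, ∫ t in Ioi (0 : ℝ), Φ t τ := integral_integral_swap h_int
    _ = _ := by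
        refine integral_congr_ae (Eventually.of_forall fun τ => ?_)
        simp only
        rw [← hGf _ (by simpa using hσ), ← integral_const_mul]
        refine integral_congr_ae (Eventually.of_forall fun t => ?_)
        simp only [hΦ]
        have : Complex.exp (Complex.I * τ * (l * (y - t) : ℝ)) * Complex.exp (-σ * t) =
            Complex.exp (Complex.I * τ * (l * y : ℝ)) *
              Complex.exp (-(σ + Complex.I * (l * τ : ℝ)) * t) := by
          rw [← Complex.exp_add, ← Complex.exp_add]; congr 1; push_cast; ring
        push_cast at this ⊢
        linear_combination ((f t : ℂ) * (1 - (|τ| : ℝ))) * this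

/-- If the Laplace transform of a bounded function extends continuously to the closed right
half-plane, then its Fejér means tend to zero. -/
theorem tendsto_fejer_mean {f : ℝ → ℝ} {M : ℝ} (hf : Measurable f) (hM : ∀ t, |f t| ≤ M)
    (h0 : ∀ t ≤ 0, f t = 0) {G : ℂ → ℂ} (hG : ContinuousOn G {s | 0 ≤ s.re})
    (hGf : ∀ s : ℂ, 0 < s.re → ∫ t in Ioi (0 : ℝ), (f t : ℂ) * Complex.exp (-s * t) = G s)
    {l : ℝ} (hl : 0 < l) :
    Tendsto (fun y => ∫ t, f t * fejer (l * (y - t))) atTop (𝓝 0) := by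
  have hM0 : 0 ≤ M := (abs_nonneg _).trans (hM 0)
  have hmem : ∀ σ τ : ℝ, 0 ≤ σ → (σ + Complex.I * (l * τ : ℝ) : ℂ) ∈ {s : ℂ | 0 ≤ s.re} := by
    intro σ τ hσ; simpa using hσ
  obtain ⟨C, hC⟩ : ∃ C, ∀ σ ∈ Icc (0 : ℝ) 1, ∀ τ ∈ Icc (-1 : ℝ) 1,
      ‖G (σ + Complex.I * (l * τ : ℝ))‖ ≤ C := by
    have hcont : ContinuousOn (fun p : ℝ × ℝ => G (p.1 + Complex.I * (l * p.2 : ℝ)))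
        (Icc (0 : ℝ) 1 ×ˢ Icc (-1 : ℝ) 1) :=
      hG.comp (Continuous.continuousOn (by fun_prop)) fun p hp => hmem _ _ hp.1.1
    obtain ⟨C, hC⟩ := (isCompact_Icc.prod isCompact_Icc).exists_bound_of_continuousOn hcont
    exact ⟨C, fun σ hσ τ hτ => hC (σ, τ) ⟨hσ, hτ⟩⟩
  have hlimit : ∀ y, ((∫ t, f t * fejer (l * (y - t)) : ℝ) : ℂ) =
      ∫ τ in Ioc (-1 : ℝ) 1, ((1 - |τ| : ℝ) : ℂ) * Complex.exp (Complex.I * τ * (l * y : ℝ)) *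
        G (Complex.I * (l * τ : ℝ)) := by
    intro y
    have hKl : Integrable (fun t => fejer (l * (y - t))) :=
      (integrable_fejer.comp_mul_left' hl.ne').comp_sub_left y
    have hL : Tendsto (fun σ : ℝ => ∫ t in Ioi (0 : ℝ),
        ((f t * Real.exp (-σ * t) * fejer (l * (y - t)) : ℝ) : ℂ)) (𝓝[>] 0)
        (𝓝 (∫ t in Ioi (0 : ℝ), ((f t * Real.exp (-0 * t) * fejer (l * (y - t)) : ℝ) : ℂ))) := by
      refine tendsto_integral_filter_of_dominated_convergence
        (fun t => M * fejer (l * (y - t))) ?_ ?_ (hKl.const_mul M).integrableOn ?_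
      · refine Eventually.of_forall fun σ => Measurable.aestronglyMeasurable ?_
        have := measurable_fejer
        fun_prop
      · filter_upwards [self_mem_nhdsWithin] with σ hσ
        filter_upwards [ae_restrict_mem measurableSet_Ioi] with t ht
        have hσ' : 0 < σ := hσ
        have ht' : 0 < t := ht
        rw [Complex.norm_real, norm_mul, norm_mul, Real.norm_of_nonneg (fejer_nonneg _),
          Real.norm_of_nonneg (Real.exp_nonneg _)]
        have h1 : Real.exp (-σ * t) ≤ 1 := Real.exp_le_one_iff.2 (by nlinarith)
        have h2 : ‖f t‖ * Real.exp (-σ * t) ≤ M * 1 :=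
          mul_le_mul (hM t) h1 (Real.exp_nonneg _) hM0
        rw [mul_one] at h2
        exact mul_le_mul_of_nonneg_right h2 (fejer_nonneg _)
      · refine Eventually.of_forall fun t => ?_
        refine Tendsto.mono_left ?_ nhdsWithin_le_nhds
        exact Continuous.tendsto (f := fun σ : ℝ =>
          ((f t * Real.exp (-σ * t) * fejer (l * (y - t)) : ℝ) : ℂ)) (by fun_prop) 0
    have hR : Tendsto (fun σ : ℝ => ∫ τ in Ioc (-1 : ℝ) 1, ((1 - |τ| : ℝ) : ℂ) *
          Complex.exp (Complex.I * τ * (l * y : ℝ)) * G (σ + Complex.I * (l * τ : ℝ))) (𝓝[>] 0)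
        (𝓝 (∫ τ in Ioc (-1 : ℝ) 1, ((1 - |τ| : ℝ) : ℂ) *
          Complex.exp (Complex.I * τ * (l * y : ℝ)) * G ((0 : ℝ) + Complex.I * (l * τ : ℝ)))) := by
      have hcont : ∀ σ : ℝ, 0 ≤ σ → ContinuousOn (fun τ : ℝ => ((1 - |τ| : ℝ) : ℂ) *
          Complex.exp (Complex.I * τ * (l * y : ℝ)) * G (σ + Complex.I * (l * τ : ℝ)))
          (Ioc (-1 : ℝ) 1) := fun σ hσ =>
        (Continuous.continuousOn (by fun_prop)).mul
          (hG.comp (Continuous.continuousOn (by fun_prop)) fun τ _ => hmem _ _ hσ)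
      refine tendsto_integral_filter_of_dominated_convergence (fun _ => 2 * C) ?_ ?_
        (integrable_const _) ?_
      · filter_upwards [self_mem_nhdsWithin] with σ hσ
        exact (hcont σ (le_of_lt hσ)).aestronglyMeasurable measurableSet_Ioc
      · filter_upwards [Ioc_mem_nhdsGT (zero_lt_one' ℝ)] with σ hσ
        filter_upwards [ae_restrict_mem measurableSet_Ioc] with τ hτ
        have h3 : ‖Complex.exp (Complex.I * τ * (l * y : ℝ))‖ = 1 := by
          rw [show Complex.I * τ * (l * y : ℝ) = ((τ * (l * y) : ℝ) : ℂ) * Complex.I by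
            push_cast; ring]
          exact Complex.norm_exp_ofReal_mul_I _
        have h4 : ‖(1 - |τ| : ℝ)‖ ≤ 2 := by
          have := abs_le.2 ⟨hτ.1.le, hτ.2⟩
          rw [Real.norm_eq_abs, abs_le]
          constructor <;> linarith [abs_nonneg τ]
        rw [norm_mul, norm_mul, h3, mul_one, Complex.norm_real]
        exact mul_le_mul h4 (hC σ ⟨hσ.1.le, hσ.2⟩ τ ⟨hτ.1.le, hτ.2⟩) (norm_nonneg _) (by norm_num)
      · refine Eventually.of_forall fun τ => Tendsto.const_mul _ ?_
        refine (hG _ (hmem 0 τ le_rfl)).tendsto.comp (tendsto_nhdsWithin_iff.2 ⟨?_, ?_⟩)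
        · refine Tendsto.mono_left ?_ nhdsWithin_le_nhds
          exact Continuous.tendsto (f := fun σ : ℝ => (σ + Complex.I * (l * τ : ℝ) : ℂ))
            (by fun_prop) 0
        · filter_upwards [self_mem_nhdsWithin] with σ hσ
          exact hmem σ τ (le_of_lt hσ)
    have heq := tendsto_nhds_unique (hL.congr' (by
      filter_upwards [self_mem_nhdsWithin] with σ hσ
      exact integral_mul_fejer_eq hf hM hGf hl hσ y)) hR
    simp only [neg_zero, zero_mul, Real.exp_zero, mul_one, Complex.ofReal_zero, zero_add] at heq
    rw [← heq, integral_complex_ofReal, setIntegral_eq_integral_of_forall_compl_eq_zero]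
    intro t ht
    rw [h0 t (not_lt.1 ht), zero_mul]
  have hRL : Tendsto (fun y : ℝ => ∫ τ : ℝ, Real.fourierChar (-(τ * (-(l * y) / (2 * Real.pi)))) •
      (Ioc (-1 : ℝ) 1).indicator
        (fun τ : ℝ => ((1 - |τ| : ℝ) : ℂ) * G (Complex.I * (l * τ : ℝ))) τ) atTop (𝓝 0) := by
    refine (Real.tendsto_integral_exp_smul_cocompact _).comp ?_
    refine Tendsto.mono_right ?_ atBot_le_cocompact
    refine Tendsto.atBot_div_const (by positivity) ?_
    exact tendsto_neg_atTop_atBot.comp (tendsto_id.const_mul_atTop hl)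
  have hC0 : Tendsto (fun y : ℝ => ((∫ t, f t * fejer (l * (y - t)) : ℝ) : ℂ)) atTop (𝓝 0) := by
    refine hRL.congr fun y => ?_
    rw [hlimit, ← integral_indicator measurableSet_Ioc]
    refine integral_congr_ae (Eventually.of_forall fun τ => ?_)
    by_cases hτ : τ ∈ Ioc (-1 : ℝ) 1
    · simp only [indicator_of_mem hτ, Circle.smul_def, Real.fourierChar_apply, smul_eq_mul]
      have : ((2 * Real.pi * (-(τ * (-(l * y) / (2 * Real.pi)))) : ℝ) : ℂ) * Complex.I =
          Complex.I * τ * (l * y : ℝ) := by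
        have hpi : (2 * Real.pi * (-(τ * (-(l * y) / (2 * Real.pi)))) : ℝ) = τ * (l * y) := by
          field_simp
        rw [hpi]; push_cast; ring
      rw [this]; ring
    · simp only [indicator_of_notMem hτ, smul_zero]
  have := (Complex.continuous_re.tendsto 0).comp hC0
  simpa only [Function.comp_def, Complex.ofReal_re, Complex.zero_re] using this

theorem laplace_eq_LSeries {b : ℕ → ℝ} (hb : ∀ n, 0 ≤ b n) {C : ℝ}
    (hC : ∀ n : ℕ, ∑ k ∈ Finset.Icc 1 n, b k ≤ C * n) {s : ℂ} (hs : 0 < s.re) :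
    LSeries (fun n => (b n : ℂ)) (s + 1) = (s + 1) * ∫ t in Ioi (0 : ℝ),
      ((∑ k ∈ Finset.Icc 1 ⌊Real.exp t⌋₊, b k) * Real.exp (-t) : ℝ) * Complex.exp (-s * t) := by
  have hO : (fun n : ℕ => ∑ k ∈ Finset.Icc 1 n, b k) =O[atTop] fun n : ℕ => (n : ℝ) ^ (1 : ℝ) := by
    refine Asymptotics.IsBigO.of_bound C (Eventually.of_forall fun n => ?_)
    rw [Real.norm_of_nonneg (Finset.sum_nonneg fun k _ => hb k), Real.rpow_one,
      Real.norm_of_nonneg (Nat.cast_nonneg n)]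
    exact hC n
  rw [LSeries_eq_mul_integral_of_nonneg b zero_le_one (s := s + 1) (by simpa using hs) hO hb]
  congr 1
  rw [← Real.exp_zero, ← Real.image_exp_Ioi, integral_image_eq_integral_abs_deriv_smul
    measurableSet_Ioi (fun x _ => (Real.hasDerivAt_exp x).hasDerivWithinAt)
    Real.exp_injective.injOn]
  refine integral_congr_ae (Eventually.of_forall fun t => ?_)
  have h1 : ((Real.exp t : ℝ) : ℂ) ^ (-(s + 1 + 1)) = Complex.exp (-(s + 1 + 1) * t) := by
    rw [Complex.cpow_def_of_ne_zero (by exact_mod_cast (Real.exp_pos t).ne'),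
      ← Complex.ofReal_log (Real.exp_pos t).le, Real.log_exp, mul_comm]
  have h2 : Complex.exp t * Complex.exp (-(s + 1 + 1) * t) =
      Complex.exp (-t) * Complex.exp (-s * t) := by
    rw [← Complex.exp_add, ← Complex.exp_add]; congr 1; ring
  simp only [h1, abs_of_pos (Real.exp_pos t), Complex.real_smul]
  push_cast
  linear_combination (∑ k ∈ Finset.Icc 1 ⌊Real.exp t⌋₊, (b k : ℂ)) * h2

/-- The Wiener–Ikehara theorem for Dirichlet series with nonnegative coefficients whose partial
sums are already known to grow at most linearly. -/
theorem tendsto_sum_div_of_LSeries_sub_pole {b : ℕ → ℝ} (hb : ∀ n, 0 ≤ b n) {C : ℝ}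
    (hC : ∀ n : ℕ, ∑ k ∈ Finset.Icc 1 n, b k ≤ C * n) {c : ℝ} (hc : 0 ≤ c) {F : ℂ → ℂ}
    (hF : ContinuousOn F {s | 1 ≤ s.re})
    (hFb : ∀ s : ℂ, 1 < s.re → F s = LSeries (fun n => (b n : ℂ)) s - c / (s - 1)) :
    Tendsto (fun n : ℕ => (∑ k ∈ Finset.Icc 1 n, b k) / (n : ℝ)) atTop (𝓝 c) := by
  set B : ℝ → ℝ := fun x => ∑ k ∈ Finset.Icc 1 ⌊x⌋₊, b k with hB
  have hBmono : Monotone B := fun x y hxy =>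
    Finset.sum_le_sum_of_subset_of_nonneg
      (Finset.Icc_subset_Icc_right (Nat.floor_le_floor hxy)) fun k _ _ => hb k
  have hB0 : ∀ x, 0 ≤ B x := fun x => Finset.sum_nonneg fun k _ => hb k
  have hC0 : 0 ≤ C := by simpa using (hB0 1).trans (by simpa [hB] using hC 1)
  have hBC : ∀ x, 0 ≤ x → B x ≤ C * x := fun x hx =>
    (hC _).trans (mul_le_mul_of_nonneg_left (Nat.floor_le hx) hC0)
  set h : ℝ → ℝ := fun t => B (Real.exp t) * Real.exp (-t) with hh
  have hhm : Measurable h := (hBmono.measurable.comp Real.measurable_exp).mul (by fun_prop)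
  have hh0 : ∀ t, 0 ≤ h t := fun t => mul_nonneg (hB0 _) (Real.exp_nonneg _)
  have hhC : ∀ t, h t ≤ C := fun t => by
    have := mul_le_mul_of_nonneg_right (hBC _ (Real.exp_nonneg t)) (Real.exp_nonneg (-t))
    rwa [mul_assoc, ← Real.exp_add, add_neg_cancel, Real.exp_zero, mul_one] at this
  have hslow : ∀ {y t}, y ≤ t → h y * Real.exp (y - t) ≤ h t := fun {y t} hyt => by
    have : h y * Real.exp (y - t) = B (Real.exp y) * Real.exp (-t) := by
      simp only [hh]; rw [mul_assoc, ← Real.exp_add]; ring_nf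
    rw [this]
    exact mul_le_mul_of_nonneg_right (hBmono (Real.exp_le_exp.2 hyt)) (Real.exp_nonneg _)
  set f : ℝ → ℝ := (Ioi (0 : ℝ)).indicator fun t => h t - c with hf
  have hfpos : ∀ {t}, 0 < t → f t = h t - c := fun {t} ht => indicator_of_mem (mem_Ioi.2 ht) _
  have hfm : Measurable f := (hhm.sub_const c).indicator measurableSet_Ioi
  have hfM : ∀ t, |f t| ≤ C + c := fun t => by
    by_cases ht : 0 < t
    · rw [hfpos ht, abs_le]
      constructor <;> linarith [hh0 t, hhC t]
    · rw [hf, indicator_of_notMem (by simpa using ht), abs_zero]; positivity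
  set G : ℂ → ℂ := fun s => (F (s + 1) - c) / (s + 1) with hG
  have hGc : ContinuousOn G {s | 0 ≤ s.re} := by
    refine ContinuousOn.div ((hF.comp (by fun_prop) fun s hs => ?_).sub continuousOn_const)
      (by fun_prop) fun s hs h0 => ?_
    · simpa using hs
    · have h1 := congrArg Complex.re h0
      have h2 : 0 ≤ s.re := hs
      simp at h1
      linarith
  have hGf : ∀ s : ℂ, 0 < s.re →
      ∫ t in Ioi (0 : ℝ), (f t : ℂ) * Complex.exp (-s * t) = G s := by
    intro s hs
    have hs0 : s ≠ 0 := by rintro rfl; simp at hs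
    have hs1 : s + 1 ≠ 0 := fun h0 => by
      have h1 := congrArg Complex.re h0
      simp at h1
      linarith
    have hexp : IntegrableOn (fun t : ℝ => Complex.exp (-s * t)) (Ioi 0) :=
      integrableOn_exp_mul_complex_Ioi (by simpa using hs) 0
    have hi : IntegrableOn (fun t : ℝ => (h t : ℂ) * Complex.exp (-s * t)) (Ioi 0) :=
      Integrable.bdd_mul (c := C) hexp (by fun_prop) (Eventually.of_forall fun t => by
        rw [Complex.norm_real, Real.norm_of_nonneg (hh0 t)]; exact hhC t)
    have h1 : ∫ t in Ioi (0 : ℝ), (f t : ℂ) * Complex.exp (-s * t) =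
        ∫ t in Ioi (0 : ℝ), ((h t : ℂ) * Complex.exp (-s * t) - c * Complex.exp (-s * t)) := by
      refine setIntegral_congr_fun measurableSet_Ioi fun t ht => ?_
      simp only [hfpos ht]; push_cast; ring
    rw [h1, integral_sub hi (hexp.const_mul _), integral_const_mul,
      integral_exp_mul_complex_Ioi (by simpa using hs)]
    have h2 := laplace_eq_LSeries hb hC hs
    have h3 := hFb (s + 1) (by simpa using hs)
    simp only [hG]
    rw [h3, h2]
    simp only [hh, hB, add_sub_cancel_right, Complex.ofReal_zero, mul_zero, Complex.exp_zero]
    field_simp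
    ring
  have hmean : ∀ l : ℝ, 0 < l → Tendsto (fun y => ∫ t, f t * fejer (l * (y - t))) atTop (𝓝 0) :=
    fun l hl => tendsto_fejer_mean hfm hfM
      (fun t ht => indicator_of_notMem (by simpa using ht) _) hGc hGf hl
  have hupper : ∀ δ : ℝ, 0 < δ → ∀ᶠ y in atTop, f y < δ := fun δ hδ => by
    refine eventually_lt_of_tendsto_kernel_mean integrable_fejer fejer_nonneg integral_fejer_pos
      hfm hfM hmean hδ ⟨δ / (4 * (δ + c)), by positivity, ?_⟩
    set η := δ / (4 * (δ + c)) with hη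
    have hη0 : 0 < η := by positivity
    have hηδ : η * (δ + c) = δ / 4 := by rw [hη]; field_simp
    filter_upwards [eventually_gt_atTop 0] with y hy hδy
    refine ⟨y + η, by linarith, fun t ht => ?_⟩
    have ht' := abs_le.1 ht
    have hyt : y ≤ t := by linarith
    rw [hfpos hy] at hδy
    rw [hfpos (hy.trans_le hyt)]
    have h1 := hslow hyt
    have h2 : 1 - 2 * η ≤ Real.exp (y - t) := by linarith [Real.add_one_le_exp (y - t)]
    have h3 : (δ + c) * Real.exp (y - t) ≤ h y * Real.exp (y - t) :=
      mul_le_mul_of_nonneg_right (by linarith) (Real.exp_nonneg _)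
    nlinarith
  have hlower : ∀ δ : ℝ, 0 < δ → ∀ᶠ y in atTop, -f y < δ := fun δ hδ => by
    refine eventually_lt_of_tendsto_kernel_mean (f := fun y => -f y) integrable_fejer fejer_nonneg
      integral_fejer_pos hfm.neg (fun t => by rw [abs_neg]; exact hfM t)
      (fun l hl => by simpa [integral_neg] using (hmean l hl).neg) hδ
      ⟨δ / (4 * (δ + c)), by positivity, ?_⟩
    set η := δ / (4 * (δ + c)) with hη
    have hη0 : 0 < η := by positivity
    have hηδ : η * (δ + c) = δ / 4 := by rw [hη]; field_simp
    filter_upwards [eventually_gt_atTop (2 * η)] with y hy hδy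
    refine ⟨y - η, le_rfl, fun t ht => ?_⟩
    have ht' := abs_le.1 ht
    have hyt : t ≤ y := by linarith
    rw [hfpos (by linarith)] at hδy ⊢
    have h1 := hslow hyt
    have h2 : 1 - 2 * η ≤ Real.exp (t - y) := by linarith [Real.add_one_le_exp (t - y)]
    have h3 : h t * (1 - 2 * η) ≤ h t * Real.exp (t - y) :=
      mul_le_mul_of_nonneg_left h2 (hh0 t)
    have h4 : 0 ≤ h y := hh0 y
    by_contra! hcon
    have h5 : 0 < 1 - 2 * η := by nlinarith
    nlinarith
  have hf0 : Tendsto f atTop (𝓝 0) := by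
    refine Metric.tendsto_nhds.2 fun δ hδ => ?_
    filter_upwards [hupper δ hδ, hlower δ hδ] with y h1 h2
    rw [Real.dist_eq, sub_zero, abs_lt]
    exact ⟨by linarith, h1⟩
  have hlog : Tendsto (fun n : ℕ => Real.log n) atTop atTop :=
    Real.tendsto_log_atTop.comp tendsto_natCast_atTop_atTop
  have := (hf0.comp hlog).add_const c
  rw [zero_add] at this
  refine this.congr' ?_
  filter_upwards [eventually_gt_atTop 1] with n hn
  have hn0 : (0 : ℝ) < n := by positivity
  have hl0 : 0 < Real.log n := Real.log_pos (by exact_mod_cast hn)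
  simp only [Function.comp_apply, hfpos hl0, hh, hB, Real.exp_log hn0, Real.exp_neg, Nat.floor_natCast]
  ring

open ArithmeticFunction in
theorem abs_ncard_mul_log_sub_sum_vonMangoldt_le (Q : Set ℕ) (n : ℕ) :
    |({p ∈ {p | p.Prime ∧ p ∈ Q} | p ≤ n}.ncard : ℝ) * Real.log n -
      ∑ k ∈ Finset.Icc 1 n, Q.indicator (fun k => vonMangoldt k) k| ≤
    (Nat.primeCounting n * Real.log n - Chebyshev.theta n) +
      (Chebyshev.psi n - Chebyshev.theta n) := by
  classical
  have hcard : ∀ R : Set ℕ, (({p ∈ {p | p.Prime ∧ p ∈ R} | p ≤ n}.ncard : ℕ) : ℝ) =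
      ∑ k ∈ Finset.Icc 1 n, R.indicator (fun k => if k.Prime then (1 : ℝ) else 0) k := by
    intro R
    have : {p ∈ {p | p.Prime ∧ p ∈ R} | p ≤ n} =
        (((Finset.Icc 1 n).filter fun p => p.Prime ∧ p ∈ R : Finset ℕ) : Set ℕ) := by
      ext p
      simp only [Set.mem_ofPred_eq, Finset.coe_filter, Finset.mem_Icc]
      constructor
      · rintro ⟨⟨h1, h2⟩, h3⟩; exact ⟨⟨h1.one_le, h3⟩, h1, h2⟩
      · rintro ⟨⟨_, h3⟩, h1, h2⟩; exact ⟨⟨h1, h2⟩, h3⟩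
    rw [this, Set.ncard_coe_finset, Finset.card_filter]
    push_cast
    refine Finset.sum_congr rfl fun k _ => ?_
    by_cases hk : k ∈ R <;> simp [hk]
  have hpi : (Nat.primeCounting n : ℝ) = ∑ k ∈ Finset.Icc 1 n, if k.Prime then (1 : ℝ) else 0 := by
    rw [← Nat.primesLE_card_eq_primeCounting, Nat.primesLE_eq_filter_Icc_zero, Finset.card_filter]
    push_cast
    rw [← Finset.add_sum_Ioc_eq_sum_Icc (Nat.zero_le n)]
    simp [Nat.not_prime_zero, ← Finset.Icc_add_one_left_eq_Ioc]
  have htheta : Chebyshev.theta n =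
      ∑ k ∈ Finset.Icc 1 n, if k.Prime then Real.log k else 0 := by
    rw [Chebyshev.theta, Finset.sum_filter, Nat.floor_natCast, ← Finset.Icc_add_one_left_eq_Ioc,
      zero_add]
  have hpsi : Chebyshev.psi n = ∑ k ∈ Finset.Icc 1 n, vonMangoldt k := by
    rw [Chebyshev.psi, Nat.floor_natCast, ← Finset.Icc_add_one_left_eq_Ioc, zero_add]
  rw [hcard, hpi, htheta, hpsi, Finset.sum_mul, Finset.sum_mul, ← Finset.sum_sub_distrib,
    ← Finset.sum_sub_distrib, ← Finset.sum_sub_distrib, ← Finset.sum_add_distrib]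
  refine (Finset.abs_sum_le_sum_abs _ _).trans (Finset.sum_le_sum fun k hk => ?_)
  have hk := Finset.mem_Icc.1 hk
  have hlog : Real.log k ≤ Real.log n :=
    Real.log_le_log (by exact_mod_cast hk.1) (by exact_mod_cast hk.2)
  have hL : 0 ≤ vonMangoldt k := vonMangoldt_nonneg
  by_cases hp : k.Prime
  · by_cases hQ : k ∈ Q
    · simp [hp, hQ, vonMangoldt_apply_prime hp, abs_of_nonneg (sub_nonneg.2 hlog)]
    · simp [hp, hQ, vonMangoldt_apply_prime hp, hlog]
  · by_cases hQ : k ∈ Q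
    · simp [hp, hQ, abs_of_nonneg hL]
    · simp [hp, hQ, hL]

theorem tendsto_chebyshev_error_div :
    Tendsto (fun n : ℕ => ((Nat.primeCounting n * Real.log n - Chebyshev.theta n) +
      (Chebyshev.psi n - Chebyshev.theta n)) / (n : ℝ)) atTop (𝓝 0) := by
  have h1 : Tendsto (fun x : ℝ => (Nat.primeCounting ⌊x⌋₊ * Real.log x - Chebyshev.theta x) / x)
      atTop (𝓝 0) := by
    have hO := Chebyshev.primeCounting_sub_theta_div_log_isBigO.mul
      (Asymptotics.isBigO_refl (fun x : ℝ => Real.log x / x) atTop)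
    have hO' : (fun x : ℝ => (Nat.primeCounting ⌊x⌋₊ * Real.log x - Chebyshev.theta x) / x)
        =O[atTop] fun x : ℝ => (Real.log x)⁻¹ := by
      refine hO.congr' ?_ ?_ <;> filter_upwards [eventually_gt_atTop 1] with x hx
      all_goals have hl := (Real.log_pos hx).ne'
      all_goals field_simp
    exact hO'.trans_tendsto Real.tendsto_log_atTop.inv_tendsto_atTop
  have h2 : Tendsto (fun x : ℝ => (Chebyshev.psi x - Chebyshev.theta x) / x) atTop (𝓝 0) := by
    have hO := Chebyshev.isBigO_psi_sub_theta_sqrt.mul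
      (Asymptotics.isBigO_refl (fun x : ℝ => x⁻¹) atTop)
    have hO' : (fun x : ℝ => (Chebyshev.psi x - Chebyshev.theta x) / x)
        =O[atTop] fun x : ℝ => (Real.sqrt x)⁻¹ := by
      refine hO.congr' ?_ ?_ <;> filter_upwards [eventually_gt_atTop 1] with x hx
      · simp [div_eq_mul_inv]
      · have := Real.sq_sqrt (show 0 ≤ x by linarith)
        have h0 : Real.sqrt x ≠ 0 := (Real.sqrt_pos.2 (by linarith)).ne'
        field_simp
        exact this
    exact hO'.trans_tendsto (Real.tendsto_sqrt_atTop).inv_tendsto_atTop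
  have := (h1.add h2).comp (tendsto_natCast_atTop_atTop (R := ℝ))
  simpa [Function.comp_def, add_div] using this

open ArithmeticFunction ArithmeticFunction.vonMangoldt in
/-- The prime number theorem in a union of residue classes. -/
theorem tendsto_ncard_primes_mem_residues (N : ℕ) [NeZero N] (A : Finset (ZMod N))
    (hA : ∀ a ∈ A, IsUnit a) :
    Tendsto (fun n : ℕ => ({p ∈ {p : ℕ | p.Prime ∧ p ∈ {k : ℕ | (k : ZMod N) ∈ A}} | p ≤ n}.ncard : ℝ) *
      Real.log n / n) atTop (𝓝 (A.card * (N.totient : ℝ)⁻¹)) := by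
  classical
  have hclass : ∀ a ∈ A, Tendsto (fun n : ℕ => (∑ k ∈ Finset.Icc 1 n, residueClass a k) / (n : ℝ))
      atTop (𝓝 (N.totient : ℝ)⁻¹) := by
    intro a ha
    refine tendsto_sum_div_of_LSeries_sub_pole (residueClass_nonneg a) (C := Real.log 4 + 4)
      (fun n => ?_) (by positivity) (continuousOn_LFunctionResidueClassAux a) fun s hs => ?_
    · refine le_trans ?_ (Chebyshev.psi_le_const_mul_self (x := n) (Nat.cast_nonneg n))
      rw [Chebyshev.psi, Nat.floor_natCast, ← Finset.Icc_add_one_left_eq_Ioc, zero_add]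
      exact Finset.sum_le_sum fun k _ => residueClass_le a k
    · have := eqOn_LFunctionResidueClassAux (hA a ha) hs
      simpa using this
  have hsum := tendsto_finsetSum A hclass
  rw [Finset.sum_const, nsmul_eq_mul] at hsum
  have herr : Tendsto (fun n : ℕ =>
      (({p ∈ {p : ℕ | p.Prime ∧ p ∈ {k : ℕ | (k : ZMod N) ∈ A}} | p ≤ n}.ncard : ℝ) *
        Real.log n - ∑ k ∈ Finset.Icc 1 n,
          {k : ℕ | (k : ZMod N) ∈ A}.indicator (fun k => vonMangoldt k) k) / n) atTop (𝓝 0) := by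
    refine squeeze_zero_norm (fun n => ?_) tendsto_chebyshev_error_div
    rw [Real.norm_eq_abs, abs_div, Nat.abs_cast]
    exact div_le_div_of_nonneg_right (abs_ncard_mul_log_sub_sum_vonMangoldt_le _ n)
      (Nat.cast_nonneg n)
  have := herr.add hsum
  rw [zero_add] at this
  refine this.congr fun n => ?_
  have hswap : ∑ k ∈ Finset.Icc 1 n,
      {k : ℕ | (k : ZMod N) ∈ A}.indicator (fun k => vonMangoldt k) k =
      ∑ a ∈ A, ∑ k ∈ Finset.Icc 1 n, residueClass a k := by
    rw [Finset.sum_comm]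
    refine Finset.sum_congr rfl fun k _ => ?_
    simp [residueClass, Set.indicator_apply]
  rw [hswap, ← Finset.sum_div]
  ring

theorem hasPrimeDensity_residues (N : ℕ) [NeZero N] (A : Finset (ZMod N))
    (hA : ∀ a ∈ A, IsUnit a) :
    HasPrimeDensity {p : ℕ | p.Prime ∧ (p : ZMod N) ∈ A} (A.card * (N.totient : ℝ)⁻¹) := by
  have h1 := tendsto_ncard_primes_mem_residues N A hA
  have h2 := tendsto_ncard_primes_mem_residues 1 {1} (by simp)
  have h3 := h1.div h2 (by simp)
  have hall : {p : ℕ | p.Prime ∧ p ∈ {k : ℕ | (k : ZMod 1) ∈ ({1} : Finset (ZMod 1))}} =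
      {p | p.Prime} := by
    ext p; simp [Subsingleton.elim (p : ZMod 1) 1]
  rw [hall] at h3
  simp only [Finset.card_singleton, Nat.totient_one, Nat.cast_one, inv_one, mul_one, div_one] at h3
  refine h3.congr' ?_
  filter_upwards [eventually_gt_atTop 1] with n hn
  have hn0 : (n : ℝ) ≠ 0 := by positivity
  have hl0 : Real.log n ≠ 0 := (Real.log_pos (by exact_mod_cast hn)).ne'
  simp only [Pi.div_apply]
  rw [div_div_div_cancel_right₀ hn0, mul_div_mul_right _ _ hl0]

end

theorem card_prescribed_signs {G ι : Type*} [Group G] [Fintype G] (S : Finset ι)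
    (χ : ι → G → ℤ) (ε : ι → ℤ) (hε : ∀ q ∈ S, ε q = 1 ∨ ε q = -1)
    (hχ : ∀ q ∈ S, ∀ u, χ q u = 1 ∨ χ q u = -1)
    (hmul : ∀ q ∈ S, ∀ u v, χ q (u * v) = χ q u * χ q v)
    (hsep : ∀ q ∈ S, ∃ v, χ q v = -1 ∧ ∀ q' ∈ S, q' ≠ q → χ q' v = 1)
    [DecidablePred fun u => ∀ q ∈ S, χ q u = ε q] :
    (2 : ℤ) ^ S.card * (Finset.univ.filter fun u => ∀ q ∈ S, χ q u = ε q).card =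
      Fintype.card G := by
  classical
  have h1 : ∀ u, ∏ q ∈ S, (1 + ε q * χ q u) =
      if ∀ q ∈ S, χ q u = ε q then (2 : ℤ) ^ S.card else 0 := by
    intro u
    split_ifs with h
    · rw [← Finset.prod_const]
      refine Finset.prod_congr rfl fun q hq => ?_
      rw [h q hq]
      rcases hε q hq with h' | h' <;> simp [h']
    · push Not at h
      obtain ⟨q, hq, hne⟩ := h
      refine Finset.prod_eq_zero hq ?_
      rcases hε q hq with h' | h' <;> rcases hχ q hq u with h'' | h'' <;> simp_all
  have h2 : ∀ U ∈ S.powerset, U ≠ ∅ → ∑ u, ∏ q ∈ U, ε q * χ q u = 0 := by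
    intro U hU hne
    have hUS := Finset.mem_powerset.1 hU
    obtain ⟨q₀, hq₀⟩ := Finset.nonempty_iff_ne_empty.2 hne
    obtain ⟨v, hv, hv'⟩ := hsep q₀ (hUS hq₀)
    have hpv : ∏ q ∈ U, χ q v = -1 := by
      rw [Finset.prod_eq_single q₀ (fun q hq hqne => hv' q (hUS hq) hqne)
        (fun h => absurd hq₀ h), hv]
    have hneg : ∑ u, ∏ q ∈ U, ε q * χ q u = -∑ u, ∏ q ∈ U, ε q * χ q u := by
      conv_lhs => rw [← Equiv.sum_comp (Equiv.mulLeft v)]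
      rw [← Finset.sum_neg_distrib]
      refine Finset.sum_congr rfl fun u _ => ?_
      rw [← neg_one_mul, ← hpv, ← Finset.prod_mul_distrib]
      refine Finset.prod_congr rfl fun q hq => ?_
      rw [Equiv.coe_mulLeft, hmul q (hUS hq)]; ring
    linarith
  calc _ = ∑ u, ∏ q ∈ S, (1 + ε q * χ q u) := by
        simp_rw [h1]
        rw [← Finset.sum_filter, Finset.sum_const, nsmul_eq_mul, mul_comm]
    _ = ∑ U ∈ S.powerset, ∑ u, ∏ q ∈ U, ε q * χ q u := by
        simp_rw [Finset.prod_one_add]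
        exact Finset.sum_comm
    _ = _ := by
        rw [Finset.sum_eq_single_of_mem ∅ (Finset.empty_mem_powerset S) h2]
        simp

/-- Given a finite set of primes `S` and `q ∈ S`, some odd `n` has `(q/n) = -1` and `(q'/n) = 1`
for all other `q' ∈ S`. -/
theorem exists_odd_jacobiSym_separating {S : Finset ℕ} (hprime : ∀ q ∈ S, q.Prime) {q : ℕ}
    (hq : q ∈ S) : ∃ n : ℕ, Odd n ∧ jacobiSym q n = -1 ∧
      ∀ q' ∈ S, q' ≠ q → jacobiSym q' n = 1 := by
  have hcop : ∀ r ∈ S, r ≠ q → Nat.Coprime q r := fun r hr hne =>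
    (Nat.coprime_primes (hprime q hq) (hprime r hr)).2 hne.symm
  have hone : ∀ {n r : ℕ}, Odd r → n % 4 = 1 → n ≡ 1 [MOD r] → jacobiSym r n = 1 := by
    intro n r hr hn hnr
    rw [jacobiSym.quadratic_reciprocity_one_mod_four' hr hn,
      jacobiSym.mod_left' (a₂ := 1) (by exact_mod_cast hnr), jacobiSym.one_left]
  rcases (hprime q hq).eq_two_or_odd' with rfl | hodd
  · have hc : Nat.Coprime 8 (∏ r ∈ S.erase 2, r) :=
      Nat.Coprime.prod_right fun r hr =>
        Nat.Coprime.pow_left 3 (hcop r (Finset.mem_of_mem_erase hr) (Finset.ne_of_mem_erase hr))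
    obtain ⟨n, hn8, hn⟩ := Nat.chineseRemainder hc 5 1
    have hn8' : n % 8 = 5 := hn8
    have hnodd : Odd n := Nat.odd_iff.2 (by omega)
    refine ⟨n, hnodd, ?_, fun r hr hne => ?_⟩
    · rw [Nat.cast_ofNat, jacobiSym.at_two hnodd, ZMod.χ₈_nat_mod_eight, hn8']
      decide
    · refine hone ((hprime r hr).odd_of_ne_two hne) (by omega) ?_
      exact hn.of_dvd (Finset.dvd_prod_of_mem _ (Finset.mem_erase.2 ⟨hne, hr⟩))
  · have : Fact q.Prime := ⟨hprime q hq⟩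
    obtain ⟨a, ha⟩ := FiniteField.exists_nonsquare (F := ZMod q)
      (by rw [ZMod.ringChar_zmod_n]; rintro rfl; exact absurd hodd (by decide))
    have hc : Nat.Coprime q (8 * ∏ r ∈ S.erase q, r) := by
      refine Nat.Coprime.mul_right ?_ (Nat.Coprime.prod_right fun r hr =>
        hcop r (Finset.mem_of_mem_erase hr) (Finset.ne_of_mem_erase hr))
      exact Nat.Coprime.pow_right 3 hodd.coprime_two_right
    obtain ⟨n, hnq, hn⟩ := Nat.chineseRemainder hc a.val 1
    have hn8 : n % 8 = 1 := hn.of_dvd (dvd_mul_right 8 _)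
    have hnodd : Odd n := Nat.odd_iff.2 (by omega)
    refine ⟨n, hnodd, ?_, fun r hr hne => ?_⟩
    · rw [jacobiSym.quadratic_reciprocity_one_mod_four' hodd (by omega)]
      refine ZMod.nonsquare_iff_jacobiSym_eq_neg_one.2 ?_
      have : ((n : ℤ) : ZMod q) = a := by
        rw [Int.cast_natCast, (ZMod.natCast_eq_natCast_iff n a.val q).2 hnq, ZMod.natCast_val,
          ZMod.cast_id]
      rwa [this]
    · rcases (hprime r hr).eq_two_or_odd' with rfl | hrodd
      · rw [Nat.cast_ofNat, jacobiSym.at_two hnodd, ZMod.χ₈_nat_mod_eight, hn8]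
        decide
      · refine hone hrodd (by omega) ?_
        exact hn.of_dvd ((Finset.dvd_prod_of_mem _ (Finset.mem_erase.2 ⟨hne, hr⟩)).mul_left 8)

theorem jacobiSym_val_natCast {q N n : ℕ} (hN : 4 * q ∣ N) (hn : Odd n) :
    jacobiSym q (n : ZMod N).val = jacobiSym q n := by
  have hodd : Odd (n % N) := hn.mod_even (even_iff_two_dvd.2 ((Dvd.intro (2 * q) (by ring)).trans hN))
  rw [ZMod.val_natCast, jacobiSym.mod_right' q hn, jacobiSym.mod_right' q hodd,
    Nat.mod_mod_of_dvd _ hN]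

theorem card_residues_prescribed_jacobiSym {S : Finset ℕ} (hprime : ∀ q ∈ S, q.Prime) {ε : ℕ → ℤ}
    (hε : ∀ q ∈ S, ε q = 1 ∨ ε q = -1) {N : ℕ} [NeZero N] (hN : N = 8 * ∏ q ∈ S, q)
    [DecidablePred fun u : (ZMod N)ˣ => ∀ q ∈ S, jacobiSym q (u : ZMod N).val = ε q] :
    (2 : ℤ) ^ S.card *
      (Finset.univ.filter fun u : (ZMod N)ˣ => ∀ q ∈ S, jacobiSym q (u : ZMod N).val = ε q).card =
      N.totient := by
  have h4 : ∀ q ∈ S, 4 * q ∣ N := fun q hq => by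
    rw [hN]; exact mul_dvd_mul (by norm_num) (Finset.dvd_prod_of_mem _ hq)
  have hval : ∀ u : (ZMod N)ˣ, Nat.Coprime (u : ZMod N).val N := ZMod.val_coe_unit_coprime
  have hodd : ∀ u : (ZMod N)ˣ, Odd (u : ZMod N).val := fun u =>
    Nat.coprime_two_right.1 ((hval u).coprime_dvd_right
      (hN ▸ Dvd.dvd.mul_right (by norm_num) _))
  rw [← ZMod.card_units_eq_totient]
  refine card_prescribed_signs S (fun q (u : (ZMod N)ˣ) => jacobiSym q (u : ZMod N).val) ε hε
    (fun q hq u => ?_) (fun q hq u v => ?_) fun q hq => ?_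
  · refine jacobiSym.eq_one_or_neg_one ?_
    rw [Int.gcd_natCast_natCast]
    exact ((hval u).coprime_dvd_right ((dvd_mul_left q 4).trans (h4 q hq))).symm
  · have h := jacobiSym_val_natCast (h4 q hq) ((hodd u).mul (hodd v))
    rw [Nat.cast_mul, ZMod.natCast_zmod_val, ZMod.natCast_zmod_val] at h
    rw [Units.val_mul, h]
    exact jacobiSym.mul_right' q (hodd u).pos.ne' (hodd v).pos.ne'
  · obtain ⟨n, hn, hnq, hnS⟩ := exists_odd_jacobiSym_separating hprime hq
    have hcop : Nat.Coprime n N := by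
      rw [hN]
      refine Nat.Coprime.mul_right (Nat.Coprime.pow_right 3 hn.coprime_two_right)
        (Nat.Coprime.prod_right fun r hr => ?_)
      by_contra hc
      have h0 : jacobiSym r n = 0 := by
        refine jacobiSym.eq_zero_iff.2 ⟨hn.pos.ne', ?_⟩
        rw [Int.gcd_natCast_natCast]
        exact fun h => hc (Nat.Coprime.symm h)
      rcases eq_or_ne r q with rfl | hne
      · rw [hnq] at h0; exact absurd h0 (by norm_num)
      · rw [hnS r hr hne] at h0; exact absurd h0 (by norm_num)
    refine ⟨ZMod.unitOfCoprime n hcop, ?_, fun r hr hne => ?_⟩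
    · simp only [ZMod.coe_unitOfCoprime]
      rw [jacobiSym_val_natCast (h4 q hq) hn, hnq]
    · simp only [ZMod.coe_unitOfCoprime]
      rw [jacobiSym_val_natCast (h4 r hr) hn, hnS r hr hne]

/-- Filaseta–Richman. Let `S` be a nonempty finite set of primes and
`ε : S → {−1, 1}`. The set of odd primes `p ∉ S` such that the Legendre symbol
`χ_p(q) = ε(q)` for all `q ∈ S` has density `2^(−|S|)` in the primes.
(For an odd prime `p` the Legendre symbol `χ_p` coincides with the Jacobi symbol `J(· | p)`.) -/
theorem density_of_prescribed_legendre_values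
    (S : Finset ℕ) (hS : S.Nonempty) (hprime : ∀ q ∈ S, q.Prime)
    (ε : ℕ → ℤ) (hε : ∀ q ∈ S, ε q = 1 ∨ ε q = -1) :
    HasPrimeDensity
      {p | p.Prime ∧ p ≠ 2 ∧ p ∉ S ∧ ∀ q ∈ S, jacobiSym (q : ℤ) p = ε q}
      ((2 : ℝ) ^ (-(S.card : ℤ))) := by
  classical
  have hN0 : 8 * ∏ q ∈ S, q ≠ 0 :=
    mul_ne_zero (by norm_num) (Finset.prod_ne_zero_iff.2 fun q hq => (hprime q hq).ne_zero)
  obtain ⟨N, hN⟩ : ∃ N, N = 8 * ∏ q ∈ S, q := ⟨_, rfl⟩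
  have : NeZero N := ⟨hN ▸ hN0⟩
  have h4 : ∀ q ∈ S, 4 * q ∣ N := fun q hq => by
    rw [hN]; exact mul_dvd_mul (by norm_num) (Finset.dvd_prod_of_mem _ hq)
  have hcard := card_residues_prescribed_jacobiSym hprime hε hN
  set U := Finset.univ.filter fun u : (ZMod N)ˣ => ∀ q ∈ S, jacobiSym q (u : ZMod N).val = ε q
    with hU
  have h := hasPrimeDensity_residues N (U.map ⟨Units.val, Units.val_injective⟩) (by
    intro a ha
    obtain ⟨u, -, rfl⟩ := Finset.mem_map.1 ha
    exact u.isUnit)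
  have hset : {p : ℕ | p.Prime ∧ p ≠ 2 ∧ p ∉ S ∧ ∀ q ∈ S, jacobiSym (q : ℤ) p = ε q} =
      {p : ℕ | p.Prime ∧ (p : ZMod N) ∈ U.map ⟨Units.val, Units.val_injective⟩} := by
    ext p
    refine and_congr_right fun hp => ⟨fun ⟨hp2, hpS, hpε⟩ => ?_, fun hpU => ?_⟩
    · have hodd := hp.odd_of_ne_two hp2
      have hcop : Nat.Coprime p N := by
        rw [hN]
        refine Nat.Coprime.mul_right (Nat.Coprime.pow_right 3 hodd.coprime_two_right)
          (Nat.Coprime.prod_right fun q hq => (Nat.coprime_primes hp (hprime q hq)).2 ?_)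
        rintro rfl
        exact hpS hq
      refine Finset.mem_map.2 ⟨ZMod.unitOfCoprime p hcop, ?_, ZMod.coe_unitOfCoprime p hcop⟩
      refine Finset.mem_filter.2 ⟨Finset.mem_univ _, fun q hq => ?_⟩
      rw [ZMod.coe_unitOfCoprime, jacobiSym_val_natCast (h4 q hq) hodd, hpε q hq]
    · obtain ⟨u, hu, hup⟩ := Finset.mem_map.1 hpU
      have hup' : (u : ZMod N) = p := hup
      have hcop : Nat.Coprime p N := (ZMod.isUnit_iff_coprime p N).1 (hup' ▸ u.isUnit)
      have hnd : ∀ d, d ∣ N → p ≠ d := by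
        rintro d hd rfl
        exact hp.one_lt.ne' (Nat.Coprime.eq_one_of_dvd hcop hd)
      have hp2 : p ≠ 2 := hnd 2 (hN ▸ Dvd.dvd.mul_right (by norm_num) _)
      refine ⟨hp2, fun hpS => hnd p ((dvd_mul_left p 4).trans (h4 p hpS)) rfl, fun q hq => ?_⟩
      rw [← (Finset.mem_filter.1 hu).2 q hq, hup',
        jacobiSym_val_natCast (h4 q hq) (hp.odd_of_ne_two hp2)]
  rw [hset]
  convert h using 1
  have hφ : (N.totient : ℝ) ≠ 0 :=
    Nat.cast_ne_zero.2 (Nat.totient_pos.2 (Nat.pos_of_ne_zero (NeZero.ne N))).ne'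
  have hcard' : (2 : ℝ) ^ S.card * U.card = N.totient := by exact_mod_cast hcard
  rw [Finset.card_map, zpow_neg, zpow_natCast]
  field_simp
  linarith
end

section
/- Let A be a nonempty finite set and let 𝒮 and 𝒯 be disjoint collections of subsets of A with ∅ ∉ 𝒮. Then the set {N ⊆ A : |N ∩ S| is odd for all S ∈ 𝒮, and |N ∩ T| is even for all T ∈ 𝒯} is nonempty if and only if for every subset U of 𝒮 ∪ 𝒯 ∪ {∅} of odd cardinality, either the cardinality of U ∩ (𝒯 ∪ {∅}) is odd or the repeated symmetric difference of the elements of U is nonempty. -/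
open scoped symmDiff

instance symmDiffCommutative {β : Type*} [DecidableEq β] :
    Std.Commutative (α := Finset β) (· ∆ ·) := ⟨fun _ _ => symmDiff_comm _ _⟩

instance symmDiffAssociative {β : Type*} [DecidableEq β] :
    Std.Associative (α := Finset β) (· ∆ ·) := ⟨fun _ _ _ => symmDiff_assoc _ _ _⟩

/-- The indicator function of a finite set, with values in the integers modulo two. -/
def indicatorModTwo {α : Type*} [DecidableEq α] (X : Finset α) : α → ZMod 2 :=
  fun a => if a ∈ X then 1 else 0

section indicatorModTwo

variable {α : Type*} [DecidableEq α]

@[simp]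
lemma indicatorModTwo_empty : indicatorModTwo (∅ : Finset α) = 0 := by
  ext a
  simp [indicatorModTwo]

lemma indicatorModTwo_eq_zero {X : Finset α} : indicatorModTwo X = 0 ↔ X = ∅ := by
  simp [indicatorModTwo, funext_iff, Finset.eq_empty_iff_forall_notMem]

lemma indicatorModTwo_symmDiff (X Y : Finset α) :
    indicatorModTwo (X ∆ Y) = indicatorModTwo X + indicatorModTwo Y := by
  ext a
  have h : (0 : ZMod 2) = 1 + 1 := by decide
  by_cases hX : a ∈ X <;> by_cases hY : a ∈ Y <;>
    simp [indicatorModTwo, Finset.mem_symmDiff, hX, hY, ← h]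

lemma indicatorModTwo_fold_symmDiff (U : Finset (Finset α)) :
    indicatorModTwo (U.fold (· ∆ ·) ∅ id : Finset α) = ∑ X ∈ U, indicatorModTwo X := by
  induction U using Finset.induction_on with
  | empty => simp
  | insert X U hX ih =>
    rw [Finset.fold_insert hX, Finset.sum_insert hX, indicatorModTwo_symmDiff, ih, id]

lemma fold_symmDiff_eq_empty_iff (U : Finset (Finset α)) :
    (U.fold (· ∆ ·) ∅ id : Finset α) = ∅ ↔ ∑ X ∈ U, indicatorModTwo X = 0 := by
  rw [← indicatorModTwo_fold_symmDiff, indicatorModTwo_eq_zero]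

lemma natCast_card_inter_eq_sum_indicatorModTwo (N X : Finset α) :
    ((N ∩ X).card : ZMod 2) = ∑ a ∈ N, indicatorModTwo X a := by
  simp [indicatorModTwo]

lemma indicatorModTwo_eq_sum_single (X : Finset α) :
    indicatorModTwo X = ∑ a ∈ X, Pi.single a (1 : ZMod 2) := by
  ext b
  simp [indicatorModTwo, Finset.sum_apply, Pi.single_apply]

/-- Fredholm alternative modulo two: if every relation among the members of `F` is respected
by `b`, then some `N ⊆ A` meets each `X ∈ F` in a set of parity `b X`. -/
lemma exists_subset_card_inter_eq (A : Finset α) (F : Finset (Finset α)) (hF : ∀ X ∈ F, X ⊆ A)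
    (b : Finset α → ZMod 2)
    (h : ∀ V ⊆ F, ∑ X ∈ V, indicatorModTwo X = 0 → ∑ X ∈ V, b X = 0) :
    ∃ N ⊆ A, ∀ X ∈ F, ((N ∩ X).card : ZMod 2) = b X := by
  have h01 : ∀ z : ZMod 2, z = 0 ∨ z = 1 := by decide
  let v : Finset α → (α → ZMod 2) × ZMod 2 := fun X => (indicatorModTwo X, b X)
  have hmem : ((0, 1) : (α → ZMod 2) × ZMod 2) ∉ Submodule.span (ZMod 2) (v '' F) := by
    intro hmem
    obtain ⟨c, hc⟩ := (Submodule.mem_span_image_finset_iff_exists_fun' (ZMod 2)).1 hmem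
    have hsum : ∑ X ∈ F with c X = 1, v X = (0, 1) := by
      rw [← hc, Finset.sum_filter]
      refine Finset.sum_congr rfl fun X _ => ?_
      rcases h01 (c X) with hX | hX <;> simp [hX]
    have h1 := congrArg Prod.fst hsum
    have h2 := congrArg Prod.snd hsum
    simp only [Prod.fst_sum, Prod.snd_sum, v] at h1 h2
    exact one_ne_zero (h2.symm.trans (h _ (Finset.filter_subset _ _) h1))
  obtain ⟨f, hf, hle⟩ := Submodule.exists_le_ker_of_notMem hmem
  have hf1 : f (0, 1) = 1 := (h01 _).resolve_left hf
  refine ⟨{a ∈ A | f (Pi.single a 1, 0) = 1}, Finset.filter_subset _ _, fun X hX => ?_⟩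
  have hv : f (indicatorModTwo X, b X) = 0 :=
    hle (Submodule.subset_span (Set.mem_image_of_mem v hX))
  have hfst : f (indicatorModTwo X, 0) = ∑ a ∈ X, f (Pi.single a 1, 0) := by
    rw [indicatorModTwo_eq_sum_single]
    exact map_sum (f ∘ₗ LinearMap.inl (ZMod 2) (α → ZMod 2) (ZMod 2)) _ _
  have hsplit : f (indicatorModTwo X, b X) = f (indicatorModTwo X, 0) + b X := by
    have : ((indicatorModTwo X, b X) : (α → ZMod 2) × ZMod 2) =
        (indicatorModTwo X, 0) + b X • (0, 1) := by simp
    rw [this, map_add, map_smul, hf1, smul_eq_mul, mul_one]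
  have hcard : (({a ∈ A | f (Pi.single a 1, 0) = 1} ∩ X).card : ZMod 2) =
      ∑ a ∈ X, f (Pi.single a 1, 0) := by
    have : {a ∈ A | f (Pi.single a 1, 0) = 1} ∩ X = {a ∈ X | f (Pi.single a 1, 0) = 1} := by
      ext a
      have := @hF X hX a
      simp only [Finset.mem_inter, Finset.mem_filter]
      tauto
    rw [this, ← Finset.sum_boole]
    refine Finset.sum_congr rfl fun a _ => ?_
    rcases h01 (f (Pi.single a 1, 0)) with ha | ha <;> simp [ha]
  rw [hcard, ← hfst]
  rw [hsplit] at hv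
  exact (CharTwo.add_eq_zero).1 hv

end indicatorModTwo

/-- Let `A` be a nonempty finite set, `𝒮` and `𝒯` disjoint collections of
subsets of `A` with `∅ ∉ 𝒮`. The set of `N ⊆ A` with `|N ∩ S|` odd for all `S ∈ 𝒮` and
`|N ∩ T|` even for all `T ∈ 𝒯` is nonempty if and only if for every subset `U` of
`𝒮 ∪ 𝒯 ∪ {∅}` of odd cardinality, either `|U ∩ (𝒯 ∪ {∅})|` is odd, or the repeated
symmetric difference of the elements of `U` is nonempty. -/
theorem parity_constrained_subsets_nonempty_iff
    {α : Type*} [DecidableEq α] (A : Finset α) (hA : A.Nonempty)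
    (𝒮 𝒯 : Finset (Finset α)) (h𝒮 : ∀ X ∈ 𝒮, X ⊆ A) (h𝒯 : ∀ X ∈ 𝒯, X ⊆ A)
    (hdisj : Disjoint 𝒮 𝒯) (hne : ∅ ∉ 𝒮) :
    (A.powerset.filter (fun N =>
        (∀ X ∈ 𝒮, Odd (N ∩ X).card) ∧ (∀ X ∈ 𝒯, Even (N ∩ X).card))).Nonempty ↔
      ∀ U ⊆ 𝒮 ∪ 𝒯 ∪ {∅}, Odd U.card →
        Odd (U ∩ (𝒯 ∪ {∅})).card ∨ ((U.fold (· ∆ ·) ∅ id : Finset α)).Nonempty := by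
  have hcard : ∀ U ⊆ 𝒮 ∪ 𝒯 ∪ {∅}, U.card = (U ∩ 𝒮).card + (U ∩ (𝒯 ∪ {∅})).card := by
    intro U hU
    have hd : Disjoint 𝒮 (𝒯 ∪ {∅}) := by simp [hdisj, hne]
    rw [← Finset.card_union_of_disjoint
      (hd.mono Finset.inter_subset_right Finset.inter_subset_right),
      ← Finset.inter_union_distrib_left, ← Finset.union_assoc, Finset.inter_eq_left.2 hU]
  have hsum : ∀ U : Finset (Finset α),
      ∑ X ∈ U, (if X ∈ 𝒮 then (1 : ZMod 2) else 0) = (U ∩ 𝒮).card := fun U => by simp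
  constructor
  · rintro ⟨N, hN⟩ U hU hodd
    simp only [Finset.mem_filter, Finset.mem_powerset] at hN
    obtain ⟨-, hNS, hNT⟩ := hN
    by_contra! ⟨hT, hfold⟩
    have hzero := (fold_symmDiff_eq_empty_iff U).1 hfold
    have hparity : ∀ X ∈ U, ((N ∩ X).card : ZMod 2) = if X ∈ 𝒮 then 1 else 0 := by
      intro X hX
      split_ifs with hS
      · exact ZMod.natCast_eq_one_iff_odd.2 (hNS X hS)
      · refine ZMod.natCast_eq_zero_iff_even.2 ?_
        have hXU := hU hX
        simp only [Finset.mem_union, Finset.mem_singleton, hS, false_or] at hXU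
        rcases hXU with hXT | rfl
        · exact hNT X hXT
        · simp
    have heven : ((U ∩ 𝒮).card : ZMod 2) = 0 := by
      rw [← hsum, ← Finset.sum_congr rfl hparity]
      simp_rw [natCast_card_inter_eq_sum_indicatorModTwo]
      rw [Finset.sum_comm]
      refine Finset.sum_eq_zero fun a _ => ?_
      rw [← Finset.sum_apply, hzero, Pi.zero_apply]
    rw [ZMod.natCast_eq_zero_iff_even] at heven
    rw [hcard U hU] at hodd
    grind
  · intro h
    obtain ⟨N, hNA, hN⟩ := exists_subset_card_inter_eq A (𝒮 ∪ 𝒯)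
      (fun X hX => (Finset.mem_union.1 hX).elim (h𝒮 X) (h𝒯 X))
      (fun X => if X ∈ 𝒮 then 1 else 0) (by
        intro V hV hzero
        rw [hsum, ZMod.natCast_eq_zero_iff_even]
        by_contra hodd
        rw [Nat.not_even_iff_odd] at hodd
        have key : ∀ U ⊆ 𝒮 ∪ 𝒯 ∪ {∅}, U.erase ∅ = V.erase ∅ →
            Odd (U ∩ (𝒯 ∪ {∅})).card := by
          intro U hU hUV
          by_contra hT
          have hUS : U ∩ 𝒮 = V ∩ 𝒮 := by
            ext X
            have := Finset.ext_iff.1 hUV X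
            grind
          have hUodd : Odd U.card := by
            rw [hcard U hU, hUS]
            exact hodd.add_even (Nat.not_odd_iff_even.1 hT)
          refine ((h U hU hUodd).resolve_left hT).ne_empty ?_
          rw [fold_symmDiff_eq_empty_iff, ← Finset.sum_erase U indicatorModTwo_empty, hUV,
            Finset.sum_erase V indicatorModTwo_empty, hzero]
        have hVe : V.erase ∅ ⊆ 𝒮 ∪ 𝒯 ∪ {∅} :=
          ((V.erase_subset ∅).trans hV).trans Finset.subset_union_left
        have h1 := key (V.erase ∅) hVe Finset.erase_idem
        have h2 := key (insert ∅ (V.erase ∅)) (Finset.insert_subset (by simp) hVe)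
          (Finset.erase_insert (Finset.notMem_erase ∅ V))
        rw [Finset.insert_inter_of_mem (by simp), Finset.card_insert_of_notMem (by simp)] at h2
        exact (Nat.odd_add_one.1 h2) h1)
    refine ⟨N, Finset.mem_filter.2 ⟨Finset.mem_powerset.2 hNA, fun X hX => ?_, fun X hX => ?_⟩⟩
    · rw [← ZMod.natCast_eq_one_iff_odd, hN X (Finset.mem_union_left _ hX), if_pos hX]
    · rw [← ZMod.natCast_eq_zero_iff_even, hN X (Finset.mem_union_right _ hX),
        if_neg (Finset.disjoint_right.1 hdisj hX)]
end

section
/- Let ℱ be a finite collection of nonempty sets, let ≃ be the equivalence relation on ℱ generated by nonempty intersection (X ≃ Y iff X = Y or there is a chain X_1, …, X_m in ℱ from X to Y with consecutive members intersecting), and let μ be the number of equivalence classes of ≃. Then the number of 2-block partitions {P_1, P_2} of ℱ with 𝒰(P_1) ∩ 𝒰(P_2) = ∅ is exactly 2^{μ−1} − 1. -/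
/-- The equivalence relation on a collection `F` of sets generated by nonempty intersection:
`Conn F X Y` holds iff `X = Y` or there is a chain `X = X_1, …, X_m = Y` of members of `F`
with `X_i ∩ X_{i+1} ≠ ∅` for all `i`. -/
def Conn {α : Type*} (F : Set (Set α)) : Set α → Set α → Prop :=
  Relation.EqvGen (fun A B => A ∈ F ∧ B ∈ F ∧ (A ∩ B).Nonempty)

/-- `Q` is a 2-block partition of `F`: two distinct nonempty blocks, pairwise disjoint,
whose union is `F`. -/
def IsTwoBlockPartition {β : Type*} (F : Set β) (Q : Set (Set β)) : Prop :=
  Q.ncard = 2 ∧ (∀ P ∈ Q, P.Nonempty) ∧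
    (∀ P ∈ Q, ∀ P' ∈ Q, P ≠ P' → Disjoint P P') ∧ ⋃₀ Q = F

/-- The equivalence class of `X` in `F`. -/
def connClass {α : Type*} (F : Set (Set α)) (X : Set α) : Set (Set α) :=
  {Y ∈ F | Conn F X Y}

theorem self_mem_connClass {α : Type*} {F : Set (Set α)} {X : Set α} (hX : X ∈ F) :
    X ∈ connClass F X :=
  ⟨hX, .refl X⟩

theorem connClass_eq_of_mem {α : Type*} {F : Set (Set α)} {X Y : Set α}
    (h : Y ∈ connClass F X) : connClass F Y = connClass F X := by
  ext Z
  exact ⟨fun hZ => ⟨hZ.1, .trans _ _ _ h.2 hZ.2⟩,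
    fun hZ => ⟨hZ.1, .trans _ _ _ (.symm _ _ h.2) hZ.2⟩⟩

/-- A block of a partition of `F` into two collections with disjoint unions is closed
under `Conn F`. -/
theorem Conn.mem_iff {α : Type*} {A B : Set (Set α)} (hAB : Disjoint (⋃₀ A) (⋃₀ B))
    {X Y : Set α} (h : Conn (A ∪ B) X Y) : X ∈ A ↔ Y ∈ A := by
  have key : ∀ {U V : Set α}, U ∈ A → V ∈ A ∪ B → (U ∩ V).Nonempty → V ∈ A := by
    rintro U V hU (hV | hV) ⟨x, hxU, hxV⟩
    · exact hV
    · exact (Set.disjoint_left.1 hAB ⟨U, hU, hxU⟩ ⟨V, hV, hxV⟩).elim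
  induction h with
  | rel U V h =>
    exact ⟨fun hU => key hU h.2.1 h.2.2, fun hV => key hV h.1 (Set.inter_comm U V ▸ h.2.2)⟩
  | refl => rfl
  | symm _ _ _ ih => exact ih.symm
  | trans _ _ _ _ _ ih₁ ih₂ => exact ih₁.trans ih₂

theorem notMem_sUnion_connClass {α : Type*} {F : Set (Set α)} {X₀ : Set α}
    {S : Set (Set (Set α))} (hS : S ⊆ connClass F '' F \ {connClass F X₀}) : X₀ ∉ ⋃₀ S := by
  rintro ⟨C, hC, hXC⟩
  obtain ⟨⟨Z, -, rfl⟩, hZ⟩ := hS hC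
  exact hZ (connClass_eq_of_mem hXC).symm

/-- A nonempty family of classes avoiding the class of `X₀` splits `F` into two blocks with
disjoint unions. -/
theorem isTwoBlockPartition_sUnion_connClass {α : Type*} {F : Set (Set α)} {X₀ : Set α}
    (hX₀ : X₀ ∈ F) {S : Set (Set (Set α))} (hS : S ⊆ connClass F '' F \ {connClass F X₀})
    (hS₀ : S.Nonempty) :
    IsTwoBlockPartition F {⋃₀ S, F \ ⋃₀ S} ∧
      ∀ P ∈ ({⋃₀ S, F \ ⋃₀ S} : Set (Set (Set α))), ∀ P' ∈ ({⋃₀ S, F \ ⋃₀ S} : Set (Set (Set α))),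
        P ≠ P' → Disjoint (⋃₀ P) (⋃₀ P') := by
  have hsub : ⋃₀ S ⊆ F := by
    rintro X ⟨C, hC, hXC⟩
    obtain ⟨Z, -, rfl⟩ := (hS hC).1
    exact hXC.1
  have hnot : X₀ ∉ ⋃₀ S := notMem_sUnion_connClass hS
  have hnon : (⋃₀ S).Nonempty := by
    obtain ⟨C, hC⟩ := hS₀
    obtain ⟨Z, hZ, rfl⟩ := (hS hC).1
    exact ⟨Z, _, hC, self_mem_connClass hZ⟩
  have hdis : Disjoint (⋃₀ ⋃₀ S) (⋃₀ (F \ ⋃₀ S)) := by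
    rw [Set.disjoint_left]
    rintro x ⟨X, ⟨C, hC, hXC⟩, hxX⟩ ⟨Y, ⟨hY, hYS⟩, hxY⟩
    obtain ⟨Z, -, rfl⟩ := (hS hC).1
    exact hYS ⟨_, hC, hY, .trans _ _ _ hXC.2 (.rel _ _ ⟨hXC.1, hY, x, hxX, hxY⟩)⟩
  refine ⟨⟨Set.ncard_pair fun h => hnot (h ▸ ⟨hX₀, hnot⟩), ?_, ?_, ?_⟩, ?_⟩
  · rintro P (rfl | rfl)
    exacts [hnon, ⟨X₀, hX₀, hnot⟩]
  · rintro P (rfl | rfl) P' (rfl | rfl) h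
    exacts [(h rfl).elim, disjoint_sdiff_self_right, disjoint_sdiff_self_left, (h rfl).elim]
  · rw [Set.sUnion_pair, Set.union_sdiff_cancel hsub]
  · rintro P (rfl | rfl) P' (rfl | rfl) h
    exacts [(h rfl).elim, hdis, hdis.symm, (h rfl).elim]

/-- The block missing `X₀` of a partition of `F` with disjoint unions is a union of classes
other than that of `X₀`. -/
theorem exists_sUnion_connClass_eq {α : Type*} {A B : Set (Set α)} {X₀ : Set α}
    (hX₀ : X₀ ∉ A) (hAB : Disjoint (⋃₀ A) (⋃₀ B)) :
    ∃ S ⊆ connClass (A ∪ B) '' (A ∪ B) \ {connClass (A ∪ B) X₀}, ⋃₀ S = A := by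
  refine ⟨connClass (A ∪ B) '' A, ?_, ?_⟩
  · rintro _ ⟨X, hX, rfl⟩
    refine ⟨⟨X, .inl hX, rfl⟩, fun h => hX₀ ?_⟩
    have hX' : X ∈ connClass (A ∪ B) X₀ := h ▸ self_mem_connClass (.inl hX)
    exact (Conn.mem_iff hAB hX'.2).2 hX
  · ext Y
    constructor
    · rintro ⟨_, ⟨X, hX, rfl⟩, hY⟩
      exact (Conn.mem_iff hAB hY.2).1 hX
    · exact fun hY => ⟨_, ⟨Y, hY, rfl⟩, self_mem_connClass (.inl hY)⟩

theorem subset_of_sUnion_subset_sUnion_connClass {α : Type*} {F : Set (Set α)}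
    {S S' : Set (Set (Set α))} (hS : S ⊆ connClass F '' F) (hS' : S' ⊆ connClass F '' F)
    (h : ⋃₀ S ⊆ ⋃₀ S') : S ⊆ S' := by
  intro C hC
  obtain ⟨X, hX, rfl⟩ := hS hC
  obtain ⟨C', hC', hXC'⟩ := h ⟨_, hC, self_mem_connClass hX⟩
  obtain ⟨Z, -, rfl⟩ := hS' hC'
  rwa [connClass_eq_of_mem hXC']

/-- Let `ℱ` be a finite collection of nonempty sets, `≃` the equivalence
relation on `ℱ` generated by nonempty intersection, and `μ` the number of its equivalence
classes. Then the number of 2-block partitions `{P₁, P₂}` of `ℱ` with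
`𝒰(P₁) ∩ 𝒰(P₂) = ∅` is exactly `2^(μ−1) − 1`. -/
theorem card_disjoint_union_partitions
    {α : Type*} (F : Set (Set α)) (hfin : F.Finite) (hne : ∀ X ∈ F, X.Nonempty)
    (μ : ℕ) (hμ : μ = {C : Set (Set α) | ∃ X ∈ F, C = {Y ∈ F | Conn F X Y}}.ncard) :
    {Q : Set (Set (Set α)) | IsTwoBlockPartition F Q ∧
        ∀ P ∈ Q, ∀ P' ∈ Q, P ≠ P' → Disjoint (⋃₀ P) (⋃₀ P')}.ncard =
      2 ^ (μ - 1) - 1 := by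
  have hclass : {C : Set (Set α) | ∃ X ∈ F, C = {Y ∈ F | Conn F X Y}} = connClass F '' F := by
    ext C
    exact exists_congr fun X => and_congr_right fun _ => eq_comm (a := C) (b := connClass F X)
  rw [hclass] at hμ
  rcases F.eq_empty_or_nonempty with rfl | ⟨X₀, hX₀⟩
  · have hempty : {Q : Set (Set (Set α)) | IsTwoBlockPartition ∅ Q ∧
        ∀ P ∈ Q, ∀ P' ∈ Q, P ≠ P' → Disjoint (⋃₀ P) (⋃₀ P')} = ∅ := by
      refine Set.eq_empty_of_forall_notMem fun Q hQ => ?_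
      obtain ⟨⟨hcard, hnon, -, hU⟩, -⟩ := hQ
      obtain ⟨P, hP⟩ := Set.nonempty_of_ncard_ne_zero (s := Q) (by omega)
      obtain ⟨X, hX⟩ := hnon P hP
      exact hU.subset ⟨P, hP, hX⟩
    rw [hempty, hμ]
    simp
  set T := connClass F '' F \ {connClass F X₀} with hT
  have hTfin : T.Finite := (hfin.image _).sdiff
  have hTcard : T.ncard = μ - 1 := by
    rw [hμ, hT, Set.ncard_sdiff_singleton_of_mem (Set.mem_image_of_mem _ hX₀)]
  have hcount : (𝒫 T \ {∅}).ncard = 2 ^ (μ - 1) - 1 := by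
    rw [Set.ncard_sdiff_singleton_of_mem (Set.empty_subset T), Set.ncard_powerset T hTfin, hTcard]
  have hinj : Set.InjOn (fun S : Set (Set (Set α)) => ({⋃₀ S, F \ ⋃₀ S} : Set (Set (Set α))))
      (𝒫 T \ {∅}) := by
    rintro S ⟨hS, -⟩ S' ⟨hS', -⟩ h
    beta_reduce at h
    have hU : ⋃₀ S = ⋃₀ S' := by
      have hmem : ⋃₀ S ∈ ({⋃₀ S', F \ ⋃₀ S'} : Set (Set (Set α))) := by
        rw [← h]
        exact .inl rfl
      rcases hmem with hmem | hmem
      · exact hmem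
      · exact (notMem_sUnion_connClass hS (hmem ▸ ⟨hX₀, notMem_sUnion_connClass hS'⟩)).elim
    have hS₁ := hS.trans Set.sdiff_subset
    have hS₁' := hS'.trans Set.sdiff_subset
    exact (subset_of_sUnion_subset_sUnion_connClass hS₁ hS₁' hU.subset).antisymm
      (subset_of_sUnion_subset_sUnion_connClass hS₁' hS₁ hU.superset)
  rw [← hcount, ← hinj.ncard_image]
  congr 1
  ext Q
  constructor
  · rintro ⟨⟨hcard, hnon, -, hU⟩, hdis⟩
    obtain ⟨A, B, hAB, hQ, hXA⟩ : ∃ A B, A ≠ B ∧ Q = {A, B} ∧ X₀ ∉ A := by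
      obtain ⟨A, B, hAB, rfl⟩ := Set.ncard_eq_two.1 hcard
      by_cases hA : X₀ ∈ A
      · by_cases hB : X₀ ∈ B
        · obtain ⟨x, hx⟩ := hne X₀ hX₀
          exact (Set.disjoint_left.1 (hdis A (.inl rfl) B (.inr rfl) hAB)
            ⟨X₀, hA, hx⟩ ⟨X₀, hB, hx⟩).elim
        · exact ⟨B, A, hAB.symm, Set.pair_comm A B, hB⟩
      · exact ⟨A, B, hAB, rfl, hA⟩
    subst hQ
    rw [Set.sUnion_pair] at hU
    subst hU
    have hd := hdis A (.inl rfl) B (.inr rfl) hAB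
    have hd' : Disjoint A B := by
      refine Set.disjoint_left.2 fun X hA hB => ?_
      obtain ⟨x, hx⟩ := hne X (.inl hA)
      exact Set.disjoint_left.1 hd ⟨X, hA, hx⟩ ⟨X, hB, hx⟩
    obtain ⟨S, hS, hSA⟩ := exists_sUnion_connClass_eq hXA hd
    refine ⟨S, ⟨hS, ?_⟩, ?_⟩
    · rintro rfl
      obtain ⟨X, hX⟩ := hnon A (.inl rfl)
      simp [← hSA] at hX
    · simp only [hSA]
      rw [Set.union_sdiff_cancel_left hd'.le_bot]
  · rintro ⟨S, ⟨hS, hS₀⟩, rfl⟩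
    exact isTwoBlockPartition_sUnion_connClass hX₀ hS (Set.nonempty_iff_ne_empty.2 hS₀)
end

section
/- Let k ≥ 2 and let (d_1, …, d_{k−1}) be a (k−1)-tuple of positive integers. Define k-tuples (a_1, …, a_k) and (b_1, …, b_k) of positive integers inductively as follows: (a_1, b_1) is arbitrary, and if i ≥ 1 and (a_i, b_i) has been defined, choose an integer t_i ≥ 2 and set a_{i+1} = t_i(a_i + d_i b_i) and b_{i+1} = t_i b_i. Then for all indices i > j in [1, k], a_i b_j − a_j b_i = (∑_{r=j}^{i−1} d_r) · b_i b_j. -/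
/-- Lemma 3.8 of the paper. Let `k ≥ 2` and `(d_1, …, d_{k−1})` be
positive integers. Define `(a_1, …, a_k)` and `(b_1, …, b_k)` inductively: `(a_1, b_1)` is an
arbitrary pair of positive integers, and given `(a_i, b_i)`, choose an integer `t_i ≥ 2` and
set `a_{i+1} = t_i (a_i + d_i b_i)`, `b_{i+1} = t_i b_i`. Then for all `1 ≤ j < i ≤ k`,
`a_i b_j − a_j b_i = (∑_{r=j}^{i−1} d_r) · b_i b_j`. -/
theorem aibj_sub_ajbi_eq
    (k : ℕ) (hk : 2 ≤ k) (d t a b : ℕ → ℕ)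
    (hd : ∀ r ∈ Finset.Icc 1 (k - 1), 0 < d r)
    (ha1 : 0 < a 1) (hb1 : 0 < b 1)
    (ht : ∀ i ∈ Finset.Icc 1 (k - 1), 2 ≤ t i)
    (hrec : ∀ i ∈ Finset.Icc 1 (k - 1),
      a (i + 1) = t i * (a i + d i * b i) ∧ b (i + 1) = t i * b i) :
    ∀ i ∈ Finset.Icc 1 k, ∀ j ∈ Finset.Icc 1 k, j < i →
      (a i * b j : ℤ) - (a j * b i : ℤ) =
        (∑ r ∈ Finset.Icc j (i - 1), (d r : ℤ)) * ((b i : ℤ) * (b j : ℤ)) := by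
  intro i hi j hj hji
  rw [Finset.mem_Icc] at hi hj
  obtain ⟨n, rfl⟩ : ∃ n, i = n + 1 := ⟨i - 1, by omega⟩
  rw [Nat.add_sub_cancel]
  have hjn : j ≤ n := by omega
  have hnk : n + 1 ≤ k := hi.2
  clear hi hji
  induction n, hjn using Nat.le_induction with
  | base =>
    obtain ⟨ha, hb⟩ := hrec j (Finset.mem_Icc.2 (by omega))
    rw [ha, hb, Finset.Icc_self, Finset.sum_singleton]
    push_cast
    ring
  | succ n hjn ih =>
    obtain ⟨ha, hb⟩ := hrec (n + 1) (Finset.mem_Icc.2 (by omega))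
    rw [ha, hb, Finset.sum_Icc_succ_top (by omega)]
    push_cast
    linear_combination (t (n + 1) : ℤ) * ih (by omega)
end
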